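/- arXiv:2403.06222 — 4 statements merged into one kernel-verified Lean document; each statement's English description precedes it below -/
import Mathlib

section
/- Let H be a real m×n matrix and I ⊆ ℝⁿ a set of samples. Define F₈ as the set of objective values ∑ᵢθᵢ + ρ over all triples (v, ρ, θ) feasible for problem (8), and F₉ as the set of objective values ∑ᵢθᵢ + ρ over all triples (y, ρ, θ) feasible for problem (9). Then the infimum of F₈ equals the infimum of F₉ (in particular, F₈ and F₉ have the same infimum as subsets of ℝ). -/
/-- **Proposition 1 (optimal-value equivalence).** The set `F₈` of objective values
`∑ᵢ θᵢ + ρ` over triples feasible for problem (8) and the set `F₉` of objective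
values over triples feasible for problem (9) have the same infimum. -/
theorem stmt_9 {m n : ℕ} (H : Matrix (Fin m) (Fin n) ℝ) (I : Set (Fin n → ℝ)) :
    let F8 : Set ℝ := {c | ∃ (v : Fin n → ℝ) (ρ : ℝ) (θ : Fin m → ℝ),
      (∀ u ∈ I, H.mulVec u - (1 - ρ) • H.mulVec v ≤ θ) ∧
      H.mulVec v ≤ 1 ∧
      ρ ∈ Set.Icc (0 : ℝ) 1 ∧ 0 ≤ θ ∧ θ ≤ 1 ∧ θ ≤ ρ • (1 : Fin m → ℝ) ∧
      c = (∑ i, θ i) + ρ}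
    let F9 : Set ℝ := {c | ∃ (y : Fin n → ℝ) (ρ : ℝ) (θ : Fin m → ℝ),
      (∀ u ∈ I, H.mulVec u - H.mulVec y ≤ θ) ∧
      H.mulVec y ≤ (1 - ρ) • (1 : Fin m → ℝ) ∧
      ρ ∈ Set.Icc (0 : ℝ) 1 ∧ 0 ≤ θ ∧ θ ≤ 1 ∧ θ ≤ ρ • (1 : Fin m → ℝ) ∧
      c = (∑ i, θ i) + ρ}
    sInf F8 = sInf F9 := by
  intro F8 F9
  congr 1
  ext c
  constructor
  · rintro ⟨v, ρ, θ, hu, hv, hρ, hθ⟩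
    refine ⟨(1 - ρ) • v, ρ, θ, fun u hmem => ?_, ?_, hρ, hθ⟩
    · rw [Matrix.mulVec_smul]
      exact hu u hmem
    · rw [Matrix.mulVec_smul]
      exact smul_le_smul_of_nonneg_left hv (sub_nonneg.2 hρ.2)
  · rintro ⟨y, ρ, θ, hu, hy, hρ, hθ⟩
    rcases hρ.2.lt_or_eq with hlt | rfl
    · have hpos : 0 < 1 - ρ := sub_pos.2 hlt
      refine ⟨(1 - ρ)⁻¹ • y, ρ, θ, fun u hmem => ?_, ?_, hρ, hθ⟩
      · rw [Matrix.mulVec_smul, smul_inv_smul₀ hpos.ne']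
        exact hu u hmem
      · rw [Matrix.mulVec_smul]
        simpa [smul_smul, hpos.ne'] using
          smul_le_smul_of_nonneg_left hy (inv_nonneg.2 hpos.le)
    -- At `ρ = 1` the rescaling is unavailable, but `H y ≤ 0` lets `v = 0` serve with the same `θ`.
    · have hy0 : H.mulVec y ≤ 0 := by simpa using hy
      refine ⟨0, 1, θ, fun u hmem => ?_, ?_, hρ, hθ⟩
      · rw [sub_self, zero_smul, sub_zero]
        exact (le_sub_self_iff _ |>.2 hy0).trans (hu u hmem)
      · rw [Matrix.mulVec_zero]
        exact zero_le_one
end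

section
/- Let H be a real m×n matrix, let (u_t)_{t∈ℕ} be a sequence of sample vectors in ℝⁿ, and let (y_t, θ_t)_{t∈ℕ} be a sequence in ℝⁿ × ℝᵐ such that for every t ≥ 1: H u_{t−1} − H y_t ≤ θ_t and H y_{t−1} + θ_{t−1} ≤ H y_t + θ_t (componentwise). Then for every t ≥ 1 and every k with 0 ≤ k ≤ t−1, u_k ∈ f(H,θ_t) ⊕ y_t; i.e., the learned set at time t contains all previously observed samples. -/
/-- The online recursion (14) loses no information: if at every step `t ≥ 1`
the constraints `H u_{t−1} − H y_t ≤ θ_t` and `H y_{t−1} + θ_{t−1} ≤ H y_t + θ_t`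
hold, then the learned set `f(H,θ_t) ⊕ y_t` at time `t` contains every previously
observed sample `u_k`, `0 ≤ k ≤ t−1`. -/
theorem stmt_12 {m n : ℕ} (H : Matrix (Fin m) (Fin n) ℝ)
    (u : ℕ → Fin n → ℝ) (y : ℕ → Fin n → ℝ) (θ : ℕ → Fin m → ℝ)
    (h1 : ∀ t, 1 ≤ t → H.mulVec (u (t - 1)) - H.mulVec (y t) ≤ θ t)
    (h2 : ∀ t, 1 ≤ t → H.mulVec (y (t - 1)) + θ (t - 1) ≤ H.mulVec (y t) + θ t) :
    ∀ t, 1 ≤ t → ∀ k, k ≤ t - 1 →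
      u k ∈ (fun z => z + y t) '' {z : Fin n → ℝ | H.mulVec z ≤ θ t} := by
  intro t ht k hk
  have hmono : Monotone fun s => H.mulVec (y s) + θ s :=
    monotone_nat_of_le_succ fun s => h2 (s + 1) (Nat.succ_pos s)
  have hsample : H.mulVec (u k) ≤ H.mulVec (y (k + 1)) + θ (k + 1) :=
    sub_le_iff_le_add'.mp (h1 (k + 1) (Nat.succ_pos k))
  refine ⟨u k - y t, ?_, sub_add_cancel _ _⟩
  rw [Set.mem_ofPred_eq, Matrix.mulVec_sub, sub_le_iff_le_add']
  exact hsample.trans (hmono (by omega : k + 1 ≤ t))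
end

section
/- Let H be a real m×n matrix and U = {u ∈ ℝⁿ : Hu ≤ 𝟏}. If (y, ρ, θ) satisfies ρ ∈ [0,1], θ ≤ ρ·𝟏, and Hy ≤ (1−ρ)·𝟏 (componentwise), then f(H,θ) ⊕ y ⊆ U; that is, the set returned by the LP (9) is always a subset of the admissible control set. -/
/-- The set returned by the LP (9) is always contained in the admissible control
set `U = {u : H u ≤ 𝟏}`: if `ρ ∈ [0,1]`, `θ ≤ ρ·𝟏` and `H y ≤ (1−ρ)·𝟏`, then
`f(H,θ) ⊕ y ⊆ U`. -/
theorem stmt_13 {m n : ℕ} (H : Matrix (Fin m) (Fin n) ℝ)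
    (y : Fin n → ℝ) (ρ : ℝ) (θ : Fin m → ℝ)
    (hρ : ρ ∈ Set.Icc (0 : ℝ) 1)
    (hθρ : θ ≤ ρ • (1 : Fin m → ℝ))
    (hy : H.mulVec y ≤ (1 - ρ) • (1 : Fin m → ℝ)) :
    (fun u => u + y) '' {u : Fin n → ℝ | H.mulVec u ≤ θ}
      ⊆ {u : Fin n → ℝ | H.mulVec u ≤ 1} := by
  rintro _ ⟨u, hu, rfl⟩
  rw [Set.mem_ofPred_eq] at hu ⊢
  calc H.mulVec (u + y) = H.mulVec u + H.mulVec y := H.mulVec_add u y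
    _ ≤ ρ • (1 : Fin m → ℝ) + (1 - ρ) • (1 : Fin m → ℝ) := add_le_add (hu.trans hθρ) hy
    _ = 1 := by rw [← add_smul, add_sub_cancel, one_smul]
end

section
/- Let H be a real m×n matrix, h ∈ ℝᵐ, and let O = {x ∈ ℝⁿ : Hx ≤ h} (componentwise). Let p ∈ ℝⁿ, d ≥ 0, and suppose there exists λ ∈ ℝᵐ with λ ≥ 0 componentwise, ‖Hᵀλ‖₂ = 1 (Euclidean norm of the vector λᵀH ∈ ℝⁿ), and λᵀ(Hp − h) ≥ d. Then for every x ∈ O, the Euclidean distance ‖p − x‖₂ ≥ d. -/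
open scoped Matrix

/-- Soundness of the dual reformulation (12e)–(12g) of the collision-avoidance
constraint: if `λ ≥ 0`, `‖Hᵀλ‖₂ = 1`, and `λᵀ(H p − h) ≥ d ≥ 0`, then every point
`x` of the polytope `O = {x : H x ≤ h}` is at Euclidean distance at least `d`
from `p`. -/
theorem stmt_16 {m n : ℕ} (H : Matrix (Fin m) (Fin n) ℝ) (h : Fin m → ℝ)
    (p : Fin n → ℝ) (d : ℝ) (hd : 0 ≤ d)
    (lam : Fin m → ℝ) (hlam : 0 ≤ lam)
    (hnorm : ‖(WithLp.equiv 2 (Fin n → ℝ)).symm (H.transpose.mulVec lam)‖ = 1)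
    (hdual : d ≤ lam ⬝ᵥ (H.mulVec p - h)) :
    ∀ x : Fin n → ℝ, H.mulVec x ≤ h →
      d ≤ ‖(WithLp.equiv 2 (Fin n → ℝ)).symm (p - x)‖ := by
  intro x hx
  have hle : lam ⬝ᵥ (H.mulVec p - h) ≤ lam ⬝ᵥ H.mulVec (p - x) := by
    rw [Matrix.mulVec_sub]
    exact dotProduct_le_dotProduct_of_nonneg_left (sub_le_sub_left hx _) hlam
  have hinner : lam ⬝ᵥ H.mulVec (p - x) =
      inner ℝ ((WithLp.equiv 2 (Fin n → ℝ)).symm (H.transpose.mulVec lam))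
        ((WithLp.equiv 2 (Fin n → ℝ)).symm (p - x)) := by
    rw [Matrix.dotProduct_mulVec, ← Matrix.mulVec_transpose, dotProduct_comm]
    simp [EuclideanSpace.inner_eq_star_dotProduct]
  calc d ≤ lam ⬝ᵥ H.mulVec (p - x) := hdual.trans hle
    _ ≤ _ := hinner.trans_le (real_inner_le_norm _ _)
    _ = _ := by rw [hnorm, one_mul]
end
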